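/- arXiv:2111.11777 — 2 statements merged into one kernel-verified Lean document; each statement's English description precedes it below -/
import Mathlib

section
/- Let G be a group and H_1 ≤ H_2 ≤ ... ≤ G an ascending chain of free subgroups of constant finite rank such that for all i, H_i is not contained in any proper free factor of H_{i+1}. Then for all i, H_1 is not contained in any proper free factor of H_i. -/
/-- `A` is a free factor of the subgroup `K` of `G`: there is a subgroup `B`
with `A ⊔ B = K` such that the natural map from the free product `A ∗ B`
to `G` is injective. -/
def IsFreeFactorOf {G : Type*} [Group G] (A K : Subgroup G) : Prop :=
  ∃ B : Subgroup G, A ⊔ B = K ∧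
    Function.Injective ⇑(Monoid.Coprod.lift A.subtype B.subtype)

/-- A cocycle `u : D → X → N` over an action of `D` on `X` gives an action of `D` on `X × N`. -/
theorem exists_skewProduct_hom {D F X N : Type*} [Group D] [Group F] [Group N] [MulAction F X]
    (i : D →* F) (u : D → X → N) (hu : ∀ d e x, u (d * e) x = u d (i e • x) * u e x) :
    ∃ ρ : D →* Equiv.Perm (X × N), ∀ d x n, ρ d (x, n) = (i d • x, u d x * n) := by
  have h1 (x : X) : u 1 x = 1 := by simpa using hu 1 1 x
  let σ : D →* Function.End (X × N) :=
    { toFun := fun d p => (i d • p.1, u d p.1 * p.2)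
      map_one' := by
        funext p
        simp [h1]
        rfl
      map_mul' := fun d e => by
        funext p
        change _ = (i d • i e • p.1, u d (i e • p.1) * (u e p.1 * p.2))
        simp [hu, mul_smul, mul_assoc] }
  exact ⟨σ.toHomPerm, fun d x n => rfl⟩

/-- The set of elements of `F` reachable from the values of `t` on `Y` by left multiplication
by elements of `B`, and by elements of `A` as long as the image of `x₀` is outside `Y`. -/
inductive ReachableFrom {F X : Type*} [Group F] [MulAction F X] (A B : Subgroup F) (x₀ : X)
    (Y : Set X) (t : X → F) : F → Prop
  | base (y : X) (hy : y ∈ Y) : ReachableFrom A B x₀ Y t (t y)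
  | left (a g : F) (ha : a ∈ A) (hg : g • x₀ ∉ Y) (h : ReachableFrom A B x₀ Y t g) :
      ReachableFrom A B x₀ Y t (a * g)
  | right (b g : F) (hb : b ∈ B) (h : ReachableFrom A B x₀ Y t g) :
      ReachableFrom A B x₀ Y t (b * g)

/-- An injective homomorphism carries free factors to free factors. -/
theorem IsFreeFactorOf.map {F G : Type*} [Group F] [Group G] {C L : Subgroup F}
    (h : IsFreeFactorOf C L) (f : F →* G) (hf : Function.Injective f) :
    IsFreeFactorOf (C.map f) (L.map f) := by
  obtain ⟨M, rfl, hM⟩ := h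
  refine ⟨M.map f, (Subgroup.map_sup C M f).symm, ?_⟩
  let eC := C.equivMapOfInjective f hf
  let eM := M.equivMapOfInjective f hf
  let e := MulEquiv.coprodCongr eC eM
  have key : ((Monoid.Coprod.lift (C.map f).subtype (M.map f).subtype).comp e.toMonoidHom) =
      f.comp (Monoid.Coprod.lift C.subtype M.subtype) := by
    ext x <;> simp [e, eC, eM]
  have hinj : Function.Injective
      ((Monoid.Coprod.lift (C.map f).subtype (M.map f).subtype).comp e.toMonoidHom) := by
    rw [key]
    exact hf.comp hM
  intro x y hxy
  obtain ⟨x, rfl⟩ := e.surjective x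
  obtain ⟨y, rfl⟩ := e.surjective y
  exact congrArg e (hinj hxy)

/-- A subgroup `L` of a free product `A ∗ B` has `L ⊓ A` as a free factor. -/
theorem isFreeFactorOf_inf_range_inl {A B F : Type*} [Group A] [Group B] [Group F]
    (e : Monoid.Coprod A B ≃* F) (L : Subgroup F) :
    IsFreeFactorOf (L ⊓ (e.toMonoidHom.comp Monoid.Coprod.inl).range) L := by
  classical
  let α : A →* F := e.toMonoidHom.comp Monoid.Coprod.inl
  let β : B →* F := e.toMonoidHom.comp Monoid.Coprod.inr
  have hind {p : F → Prop} (hα : ∀ a, p (α a)) (hβ : ∀ b, p (β b))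
      (hmul : ∀ g h, p g → p h → p (g * h)) (g : F) : p g := by
    obtain ⟨g, rfl⟩ := e.surjective g
    induction g using Monoid.Coprod.induction_on with
    | inl a => exact hα a
    | inr b => exact hβ b
    | mul g h hg hh => exact map_mul e g h ▸ hmul _ _ hg hh
  let x₀ : F ⧸ L := ((1 : F) : F ⧸ L)
  have hstab (g : F) : g • x₀ = x₀ ↔ g ∈ L := by
    rw [← MulAction.mem_stabilizer_iff, MulAction.stabilizer_quotient]
  let Y : Set (F ⧸ L) := {x | ∃ a, α a • x₀ = x}
  have hY (a : A) (x : F ⧸ L) : α a • x ∈ Y ↔ x ∈ Y := by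
    constructor
    · rintro ⟨a', h⟩
      exact ⟨a⁻¹ * a', by rw [map_mul, mul_smul, h, map_inv, inv_smul_smul]⟩
    · rintro ⟨a', rfl⟩
      exact ⟨a * a', by rw [map_mul, mul_smul]⟩
  have hx₀Y : x₀ ∈ Y := ⟨1, by simp⟩
  have ht : ∀ x : F ⧸ L, ∃ g : F, (x = x₀ → g = 1) ∧ (x ∈ Y → g ∈ α.range ∧ g • x₀ = x) := by
    intro x
    by_cases hx : x = x₀
    · exact ⟨1, fun _ => rfl, fun _ => ⟨one_mem _, by rw [one_smul, hx]⟩⟩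
    · by_cases hxY : x ∈ Y
      · obtain ⟨a, ha⟩ := hxY
        exact ⟨α a, fun h => absurd h hx, fun _ => ⟨⟨a, rfl⟩, ha⟩⟩
      · exact ⟨1, fun _ => rfl, fun h => absurd h hxY⟩
  choose t ht1 htY using ht
  let R : F → Prop := ReachableFrom α.range β.range x₀ Y t
  have hreach : ∀ g : F, ∀ x : F ⧸ L, (∃ r, R r ∧ r • x₀ = x) → ∃ r, R r ∧ r • x₀ = g • x := by
    intro g
    induction g using hind with
    | hα a =>
      rintro x ⟨r, hr, rfl⟩
      by_cases hrY : r • x₀ ∈ Y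
      · exact ⟨_, .base _ ((hY a _).2 hrY), (htY _ ((hY a _).2 hrY)).2⟩
      · exact ⟨α a * r, .left _ _ ⟨a, rfl⟩ hrY hr, mul_smul _ _ _⟩
    | hβ b =>
      rintro x ⟨r, hr, rfl⟩
      exact ⟨β b * r, .right _ _ ⟨b, rfl⟩ hr, mul_smul _ _ _⟩
    | hmul g g' hg hg' =>
      intro x hx
      rw [mul_smul]
      exact hg _ (hg' _ hx)
  have hq : ∀ x : F ⧸ L, ∃ g : F, R g ∧ g • x₀ = x ∧ (x ∈ Y → g = t x) := by
    intro x
    by_cases hxY : x ∈ Y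
    · exact ⟨t x, .base _ hxY, (htY _ hxY).2, fun _ => rfl⟩
    · obtain ⟨g, rfl⟩ := QuotientGroup.mk_surjective x
      obtain ⟨r, hr, hrx⟩ := hreach g x₀ ⟨t x₀, .base _ hx₀Y, (htY _ hx₀Y).2⟩
      have hg : g • x₀ = (g : F ⧸ L) := by
        change ((g * 1 : F) : F ⧸ L) = _
        rw [mul_one]
      exact ⟨r, hr, hrx.trans hg, fun h => absurd h hxY⟩
  choose q hqR hqx hqY using hq
  have hq1 : q x₀ = 1 := by rw [hqY _ hx₀Y, ht1 _ rfl]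
  let w (g : F) (x : F ⧸ L) : F := (q (g • x))⁻¹ * g * q x
  have hw (g h : F) (x : F ⧸ L) : w (g * h) x = w g (h • x) * w h x := by
    simp only [w, mul_smul, mul_assoc, mul_inv_cancel_left]
  have hwL (g : F) (x : F ⧸ L) : w g x ∈ L := by
    rw [← hstab]
    simp only [w, mul_smul, hqx]
    rw [inv_smul_eq_iff, hqx]
  let C : Subgroup F := L ⊓ α.range
  let M : Subgroup F := Subgroup.closure
    ({z | ∃ b x, w (β b) x = z} ∪ {z | ∃ a, ∃ x ∉ Y, w (α a) x = z})
  have hMβ (b : B) (x : F ⧸ L) : w (β b) x ∈ M := Subgroup.subset_closure (.inl ⟨b, x, rfl⟩)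
  have hMα (a : A) (x : F ⧸ L) (hx : x ∉ Y) : w (α a) x ∈ M :=
    Subgroup.subset_closure (.inr ⟨a, x, hx, rfl⟩)
  have hCα (a : A) (x : F ⧸ L) (hx : x ∈ Y) : w (α a) x ∈ C := by
    refine Subgroup.mem_inf.2 ⟨hwL _ _, ?_⟩
    have h1 : q (α a • x) ∈ α.range := by
      have := (hY a x).2 hx
      rw [hqY _ this]
      exact (htY _ this).1
    have h2 : q x ∈ α.range := by
      rw [hqY _ hx]
      exact (htY _ hx).1
    exact α.range.mul_mem (α.range.mul_mem (α.range.inv_mem h1) ⟨a, rfl⟩) h2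
  have hML : M ≤ L := by
    rw [Subgroup.closure_le]
    rintro z (⟨b, x, rfl⟩ | ⟨a, x, -, rfl⟩) <;> exact hwL _ _
  refine ⟨M, le_antisymm (sup_le inf_le_left hML) ?_, ?_⟩
  · have hgen : ∀ g : F, ∀ x, w g x ∈ C ⊔ M := by
      intro g
      induction g using hind with
      | hα a =>
        intro x
        by_cases hx : x ∈ Y
        · exact Subgroup.mem_sup_left (hCα a x hx)
        · exact Subgroup.mem_sup_right (hMα a x hx)
      | hβ b => exact fun x => Subgroup.mem_sup_right (hMβ b x)
      | hmul g g' hg hg' =>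
        intro x
        rw [hw]
        exact mul_mem (hg _) (hg' _)
    intro g hg
    have := hgen g x₀
    simpa only [w, (hstab g).2 hg, hq1, inv_one, one_mul, mul_one] using this
  · let N := Monoid.Coprod C M
    let jC : C →* N := Monoid.Coprod.inl
    let jM : M →* N := Monoid.Coprod.inr
    obtain ⟨ρA, hρA⟩ := exists_skewProduct_hom (N := N) (X := F ⧸ L) α
      (fun a x => if hx : x ∈ Y then jC ⟨_, hCα a x hx⟩ else jM ⟨_, hMα a x hx⟩) (by
        intro d e x
        by_cases hx : x ∈ Y
        · have hx' := (hY e x).2 hx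
          simp only [hx, hx', dif_pos, ← map_mul]
          congr 1
          exact Subtype.ext (by simp [hw])
        · have hx' := mt (hY e x).1 hx
          simp only [hx, hx', dif_neg, not_false_eq_true, ← map_mul]
          congr 1
          exact Subtype.ext (by simp [hw]))
    obtain ⟨ρB, hρB⟩ := exists_skewProduct_hom (N := N) (X := F ⧸ L) β
      (fun b x => jM ⟨_, hMβ b x⟩) (by
        intro d e x
        rw [← map_mul]
        congr 1
        exact Subtype.ext (by simp [hw]))
    let ρ : F →* Equiv.Perm ((F ⧸ L) × N) := (Monoid.Coprod.lift ρA ρB).comp e.symm.toMonoidHom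
    have hρα (a : A) : ρ (α a) = ρA a := by simp [ρ, α]
    have hρβ (b : B) : ρ (β b) = ρB b := by simp [ρ, β]
    have hρR : ∀ g, R g → ∃ m : M, (m : F) = (q (g • x₀))⁻¹ * g ∧
        ∀ n, ρ g (x₀, n) = (g • x₀, jM m * n) := by
      intro g hg
      induction hg with
      | base y hy =>
        have hty : (q (t y • x₀))⁻¹ * t y = 1 := by
          rw [(htY y hy).2, hqY y hy, inv_mul_cancel]
        refine ⟨1, hty.symm, fun n => ?_⟩
        obtain ⟨a, ha⟩ := (htY y hy).1
        have h1 : (⟨_, hCα a x₀ hx₀Y⟩ : C) = 1 := Subtype.ext (by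
          simp only [w, ha, hq1, mul_one, hty, Subgroup.coe_one])
        rw [← ha, hρα, hρA, dif_pos hx₀Y, h1, map_one, map_one]
      | left a g ha hg hr ih =>
        obtain ⟨a, rfl⟩ := ha
        obtain ⟨m, hm, ih⟩ := ih
        refine ⟨⟨_, hMα a _ hg⟩ * m, ?_, fun n => ?_⟩
        · simp only [Subgroup.coe_mul, hm, w, mul_smul, mul_assoc, mul_inv_cancel_left]
        · rw [map_mul, Equiv.Perm.mul_apply, ih, hρα, hρA, dif_neg hg, mul_smul, map_mul,
            mul_assoc]
      | right b g hb hr ih =>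
        obtain ⟨b, rfl⟩ := hb
        obtain ⟨m, hm, ih⟩ := ih
        refine ⟨⟨_, hMβ b (g • x₀)⟩ * m, ?_, fun n => ?_⟩
        · simp only [Subgroup.coe_mul, hm, w, mul_smul, mul_assoc, mul_inv_cancel_left]
        · rw [map_mul, Equiv.Perm.mul_apply, ih, hρβ, hρB, mul_smul, map_mul, mul_assoc]
    have hρq (x : F ⧸ L) (n : N) : ρ (q x) (x₀, n) = (x, n) := by
      obtain ⟨m, hm, hn⟩ := hρR (q x) (hqR x)
      have h1 : m = 1 := Subtype.ext (by simp [hm, hqx])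
      rw [hn, h1, map_one, one_mul, hqx]
    have hρw (g : F) (x : F ⧸ L) (k n : N) (h : ρ g (x, n) = (g • x, k * n)) :
        ρ (w g x) (x₀, n) = (x₀, k * n) := by
      simp only [w, map_mul, Equiv.Perm.mul_apply, hρq, h, map_inv]
      rw [Equiv.Perm.inv_eq_iff_eq, hρq]
    have hρC (c : C) (n : N) : ρ c (x₀, n) = (x₀, jC c * n) := by
      obtain ⟨c, hcL, a, rfl⟩ := c
      have h1 : (⟨_, hCα a x₀ hx₀Y⟩ : C) = ⟨α a, hcL, a, rfl⟩ := Subtype.ext (by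
        simp [w, (hstab (α a)).2 hcL, hq1])
      change ρ (α a) _ = _
      rw [hρα, hρA, dif_pos hx₀Y, h1, (hstab (α a)).2 hcL]
    have hρM : ∀ m (hm : m ∈ M) (n : N), ρ m (x₀, n) = (x₀, jM ⟨m, hm⟩ * n) := by
      intro m hm
      induction hm using Subgroup.closure_induction with
      | mem z hz =>
        intro n
        obtain ⟨b, x, rfl⟩ | ⟨a, x, hx, rfl⟩ := hz
        · exact hρw _ _ _ _ (by rw [hρβ, hρB])
        · exact hρw _ _ _ _ (by rw [hρα, hρA, dif_neg hx])
      | one =>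
        intro n
        have h1 : (⟨1, one_mem M⟩ : M) = 1 := rfl
        rw [h1, map_one, map_one, one_mul, Equiv.Perm.one_apply]
      | mul y z hy hz ihy ihz =>
        intro n
        have h1 : (⟨y * z, mul_mem hy hz⟩ : M) = ⟨y, hy⟩ * ⟨z, hz⟩ := rfl
        rw [h1, map_mul, map_mul, Equiv.Perm.mul_apply, ihz, ihy, mul_assoc]
      | inv y hy ih =>
        intro n
        have h1 : (⟨y⁻¹, inv_mem hy⟩ : M) = ⟨y, hy⟩⁻¹ := rfl
        rw [h1, map_inv, map_inv, Equiv.Perm.inv_eq_iff_eq, ih, mul_inv_cancel_left]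
    have hρN : ∀ v : N, ∀ n, ρ (Monoid.Coprod.lift C.subtype M.subtype v) (x₀, n) =
        (x₀, v * n) := by
      intro v
      induction v using Monoid.Coprod.induction_on with
      | inl c => exact fun n => by simpa using hρC c n
      | inr m => exact fun n => by simpa using hρM m m.2 n
      | mul v v' hv hv' =>
        intro n
        rw [map_mul, map_mul, Equiv.Perm.mul_apply, hv', hv, mul_assoc]
    intro v v' h
    have h1 := hρN v 1
    rw [h, hρN v' 1] at h1
    exact (mul_right_cancel (congrArg Prod.snd h1)).symm

/-- If `A` is a free factor of `K` and `L ≤ K`, then `L ⊓ A` is a free factor of `L`. -/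
theorem IsFreeFactorOf.inf_left {G : Type*} [Group G] {A K L : Subgroup G}
    (h : IsFreeFactorOf A K) (hLK : L ≤ K) : IsFreeFactorOf (L ⊓ A) L := by
  obtain ⟨B, rfl, hinj⟩ := h
  set f := Monoid.Coprod.lift A.subtype B.subtype with hf
  have hrange : f.range = A ⊔ B := by
    rw [hf, Monoid.Coprod.range_lift, Subgroup.range_subtype, Subgroup.range_subtype]
  have hL : (L.comap f).map f = L := by
    rw [Subgroup.map_comap_eq, hrange, inf_eq_right.2 hLK]
  have hA : ((MulEquiv.refl (Monoid.Coprod A B)).toMonoidHom.comp Monoid.Coprod.inl).range.map f =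
      A := by
    change (Monoid.Coprod.inl : A →* Monoid.Coprod A B).range.map f = A
    rw [← MonoidHom.range_comp, hf, Monoid.Coprod.lift_comp_inl, Subgroup.range_subtype]
  have := (isFreeFactorOf_inf_range_inl (MulEquiv.refl _) (L.comap f)).map f hinj
  rwa [Subgroup.map_inf _ _ _ hinj, hL, hA] at this

/-- If in an ascending chain of free subgroups of constant rank each term is
not contained in a proper free factor of the next, then the first term is not
contained in a proper free factor of any term. -/
theorem first_term_avoids_free_factors {G : Type*} [Group G] (r : ℕ)
    (H : ℕ → Subgroup G) (hmono : Monotone H)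
    (hfree : ∀ i, Nonempty (↥(H i) ≃* FreeGroup (Fin r)))
    (havoid : ∀ i (A : Subgroup G), IsFreeFactorOf A (H (i + 1)) →
      A ≠ H (i + 1) → ¬ H i ≤ A) :
    ∀ i (A : Subgroup G), IsFreeFactorOf A (H i) → A ≠ H i → ¬ H 0 ≤ A := by
  intro i
  induction i with
  | zero =>
    rintro A ⟨B, hAB, -⟩ hne hle
    exact hne (le_antisymm (hAB ▸ le_sup_left) hle)
  | succ i ih =>
    intro A hA hne hle
    have hmem := hA.inf_left (hmono i.le_succ)
    by_cases heq : H i ⊓ A = H i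
    · exact havoid i A hA hne (inf_eq_left.1 heq)
    · exact ih _ hmem heq (le_inf (hmono i.zero_le) hle)
end

section
/- Let F be a free group of finite rank and suppose F is an HNN extension of a finitely generated group L over an infinite cyclic associated subgroup. Then L is free and rank(L) = rank(F). -/
theorem Equiv.Perm.exists_not_commute_sumCongrHom {X : Type*} {σ : Equiv.Perm X} (hσ : σ ≠ 1) :
    ∃ τ : Equiv.Perm (X ⊕ Unit),
      τ * Equiv.Perm.sumCongrHom X Unit (σ, 1) ≠ Equiv.Perm.sumCongrHom X Unit (σ, 1) * τ := by
  classical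
  obtain ⟨x, hx⟩ : ∃ x, σ x ≠ x := by
    by_contra! h
    exact hσ (Equiv.ext h)
  refine ⟨Equiv.swap (Sum.inl x) (Sum.inr ()), fun h ↦ ?_⟩
  have := Equiv.congr_fun h (Sum.inr ())
  exact hx (by simpa using this.symm)

/-- Partial left translation by `g` on a finite subset `S` of a group extends to a permutation
of `S`. -/
theorem exists_perm_extending_mul_left {G : Type*} [Group G] (S : Set G) [Finite S] (g : G) :
    ∃ e : Equiv.Perm S, ∀ s t : S, g * s = t → e s = t := by
  classical
  have := Fintype.ofFinite S
  let e : {s : S // g * s ∈ S} ≃ {t : S // g⁻¹ * t ∈ S} :=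
    { toFun s := ⟨⟨g * s.1, s.2⟩, by simp⟩
      invFun t := ⟨⟨g⁻¹ * t.1, t.2⟩, by simp⟩
      left_inv s := by simp
      right_inv t := by simp }
  refine ⟨e.extendSubtype, fun s t h ↦ ?_⟩
  rw [e.extendSubtype_apply_of_mem s (h ▸ t.2)]
  exact Subtype.ext h

theorem FreeGroup.exists_finite_perm_ne_one.{u} {α : Type u} {w : FreeGroup α} (hw : w ≠ 1) :
    ∃ (X : Type u) (_ : Finite X) (f : FreeGroup α →* Equiv.Perm X), f w ≠ 1 := by
  obtain ⟨L, rfl⟩ : ∃ L, FreeGroup.mk L = w := Quot.exists_rep w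
  let S : Set (FreeGroup α) := FreeGroup.mk '' {M | M <:+ L}
  have hfin : Finite S := by
    refine Set.Finite.image _ ((List.finite_toSet L.tails).subset fun M hM ↦ ?_)
    simpa using hM
  choose e he using fun x : α ↦ exists_perm_extending_mul_left S (FreeGroup.of x)
  let f : FreeGroup α →* Equiv.Perm S := FreeGroup.lift e
  have hmem {M : List (α × Bool)} (hM : M <:+ L) : FreeGroup.mk M ∈ S := ⟨M, hM, rfl⟩
  have key (M : List (α × Bool)) (hM : M <:+ L) :
      f (FreeGroup.mk M) ⟨FreeGroup.mk [], hmem (List.nil_suffix)⟩ = ⟨FreeGroup.mk M, hmem hM⟩ := by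
    induction M with
    | nil => simp [← FreeGroup.one_eq_mk]
    | cons p M ih =>
      have hM' := (List.suffix_cons p M).trans hM
      have hmk : f (FreeGroup.mk (p :: M)) = f (FreeGroup.mk [p]) * f (FreeGroup.mk M) := by
        simp [← MonoidHom.map_mul]
      rw [hmk, Equiv.Perm.mul_apply, ih hM']
      obtain ⟨x, _ | _⟩ := p
      · have hx : FreeGroup.mk [(x, false)] = (FreeGroup.of x)⁻¹ := rfl
        have hfx : f (FreeGroup.of x) = e x := by simp [f]
        simp only [hx, MonoidHom.map_inv, hfx]
        rw [Equiv.Perm.inv_eq_iff_eq]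
        exact (he x _ _ (mul_inv_cancel_left (FreeGroup.of x) (FreeGroup.mk M))).symm
      · have hfx : f (FreeGroup.mk [(x, true)]) = e x := by
          change f (FreeGroup.of x) = e x
          simp [f]
        rw [hfx]
        exact he x _ _ rfl
  refine ⟨S, hfin, f, fun h ↦ hw ?_⟩
  have := key L List.suffix_rfl
  rw [h] at this
  simpa [FreeGroup.one_eq_mk] using (congrArg Subtype.val this).symm

theorem FreeGroupBasis.card_monoidHom {ι G K : Type*} [Group G] [Group K] [Finite ι]
    (B : FreeGroupBasis ι G) : Nat.card (G →* K) = Nat.card K ^ Nat.card ι := by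
  rw [← Nat.card_congr B.lift, Nat.card_fun]

namespace HNNExtension

variable {G K : Type*} [Group G] [Group K] {A B : Subgroup G} {φ : A ≃* B}

theorem restrict_injective :
    Function.Injective fun f : HNNExtension G A B φ →* K ↦ (f.comp of, f t) :=
  fun _ _ h ↦ hom_ext (congrArg Prod.fst h) (congrArg Prod.snd h)

theorem card_monoidHom_lt [Finite K] [Finite (G →* K)] (f : G →* K) (a : A) (x : K)
    (hx : x * f a ≠ f a * x) :
    Nat.card (HNNExtension G A B φ →* K) < Nat.card (G →* K) * Nat.card K := by
  rw [← Nat.card_prod, ← not_le]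
  intro hle
  have hsurj := (restrict_injective (K := K) (φ := φ)).bijective_of_nat_card_le hle |>.2
  have hrel (y : K) : y * f a = f (φ a) * y := by
    obtain ⟨F, hF⟩ := hsurj (f, y)
    obtain ⟨rfl, rfl⟩ := Prod.ext_iff.1 hF
    simpa using congrArg F (t_mul_of a)
  have h1 := hrel 1
  rw [one_mul, mul_one] at h1
  exact hx (h1 ▸ hrel x)

/-- Homomorphisms to the group of order two from the base of an HNN extension with cyclic
associated subgroups are no more numerous than those from the extension. -/
theorem exists_monoidHom_injection {a b : G} (φ : Subgroup.zpowers a ≃* Subgroup.zpowers b) :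
    ∃ j : (G →* ℤˣ) → (HNNExtension G (Subgroup.zpowers a) (Subgroup.zpowers b) φ →* ℤˣ),
      Function.Injective j := by
  classical
  let c : Subgroup.zpowers a := ⟨a, Subgroup.mem_zpowers a⟩
  have ext_rel (f : G →* ℤˣ) (h : f a = f (φ c)) (x : ℤˣ) (y : Subgroup.zpowers a) :
      x * f y = f (φ y : G) * x := by
    obtain ⟨_, n, rfl⟩ := y
    have : (⟨a ^ n, n, rfl⟩ : Subgroup.zpowers a) = c ^ n := rfl
    simp only [this, map_zpow, Subgroup.coe_zpow, ← h, mul_comm x, c]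
  by_cases hall : ∃ f₀ : G →* ℤˣ, f₀ a ≠ f₀ (φ c)
  · obtain ⟨f₀, h₀⟩ := hall
    have hmul (f : G →* ℤˣ) (h : f a ≠ f (φ c)) : (f * f₀) a = (f * f₀) (φ c) := by
      rw [MonoidHom.mul_apply, MonoidHom.mul_apply, Int.units_ne_iff_eq_neg.1 h,
        Int.units_ne_iff_eq_neg.1 h₀, neg_mul_neg]
    refine ⟨fun f ↦ if h : f a = f (φ c) then lift f 1 (ext_rel f h 1)
      else lift (f * f₀) (-1) (ext_rel _ (hmul f h) (-1)), fun f g hfg ↦ ?_⟩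
    have ht := DFunLike.congr_fun hfg t
    have hof (x : G) := DFunLike.congr_fun hfg (of x)
    ext x : 1
    by_cases hf : f a = f (φ c) <;> by_cases hg : g a = g (φ c) <;>
      simp [hf, hg] at ht hof
    · exact hof x
    · exact hof x
  · push Not at hall
    refine ⟨fun f ↦ lift f 1 (ext_rel f (hall f) 1), fun f g hfg ↦ ?_⟩
    ext x : 1
    simpa using DFunLike.congr_fun hfg (of x)

end HNNExtension

theorem FreeGroupBasis.finite_of_finite_monoidHom {ι G : Type*} [Group G]
    (B : FreeGroupBasis ι G) [Finite (G →* ℤˣ)] : Finite ι := by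
  classical
  have : Finite (ι → ℤˣ) := Finite.of_equiv _ B.lift.symm
  refine Finite.of_injective (fun i : ι ↦ (Pi.mulSingle i (-1) : ι → ℤˣ)) fun i j h ↦ ?_
  by_contra hij
  have := congrFun h i
  simp [Pi.mulSingle_eq_of_ne hij] at this

/-- Swarup's theorem: if an HNN extension of a finitely generated group `L`
over infinite cyclic associated subgroups is free of finite rank `r`, then `L`
is free of rank `r`. -/
theorem swarup {L : Type*} [Group L] (a b : L)
    (ha : ¬ IsOfFinOrder a) (hb : ¬ IsOfFinOrder b)
    (φ : Subgroup.zpowers a ≃* Subgroup.zpowers b)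
    (r : ℕ) (hLfg : Group.FG L)
    (hfree : Nonempty
      (HNNExtension L (Subgroup.zpowers a) (Subgroup.zpowers b) φ ≃*
        FreeGroup (Fin r))) :
    Nonempty (L ≃* FreeGroup (Fin r)) := by
  obtain ⟨e⟩ := hfree
  let E := FreeGroupBasis.ofRepr e
  let ψ : L →* FreeGroup (Fin r) := e.toMonoidHom.comp HNNExtension.of
  have hψ : Function.Injective ψ := e.injective.comp (HNNExtension.of_injective φ)
  let B := (IsFreeGroup.basis ψ.range).map (ψ.ofInjective hψ).symm
  obtain ⟨j, hj⟩ := HNNExtension.exists_monoidHom_injection φ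
  have hfinE : Finite (HNNExtension L (Subgroup.zpowers a) (Subgroup.zpowers b) φ →* ℤˣ) :=
    Finite.of_equiv _ E.lift
  have hfinL : Finite (L →* ℤˣ) := Finite.of_injective j hj
  have hfin := B.finite_of_finite_monoidHom
  have hle := Nat.card_le_card_of_injective j hj
  rw [B.card_monoidHom, E.card_monoidHom, Nat.card_fin,
    Nat.pow_le_pow_iff_right (by simp)] at hle
  have ha1 : ψ a ≠ 1 := fun h ↦ ha <| by
    rw [(map_eq_one_iff ψ hψ).1 h]
    exact IsOfFinOrder.one
  obtain ⟨X, _, f, hf⟩ := FreeGroup.exists_finite_perm_ne_one ha1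
  obtain ⟨τ, hτ⟩ := Equiv.Perm.exists_not_commute_sumCongrHom hf
  let g : L →* Equiv.Perm (X ⊕ Unit) :=
    (Equiv.Perm.sumCongrHom X Unit).comp ((f.comp ψ).prod 1)
  have : Finite (L →* Equiv.Perm (X ⊕ Unit)) := Finite.of_equiv _ B.lift
  have hlt := HNNExtension.card_monoidHom_lt (φ := φ) g ⟨a, Subgroup.mem_zpowers a⟩ τ hτ
  rw [B.card_monoidHom, E.card_monoidHom, ← pow_succ, Nat.card_fin] at hlt
  have hr := Nat.lt_succ_iff.1 ((pow_right_mono₀ Nat.card_pos).reflect_lt hlt)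
  exact ⟨(B.reindex (Finite.equivFinOfCardEq (hle.antisymm hr))).repr⟩
end
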